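/- arXiv:1204.3161 — 3 statements merged into one kernel-verified Lean document; each statement's English description precedes it below -/
import Mathlib

section
/- Fix an odd integer d = 2m + 1 ≥ 5. Then m + 1 is a typical rank for real bivariate homogeneous forms of degree d. -/
/-!
We model the space `K[x,y]_d` of degree-`d` homogeneous bivariate forms over `K`
by its coefficient vectors `Fin (d+1) → K`, where `f i` is the coefficient of
`x^i * y^(d-i)`.  A linear form `p*x + q*y ∈ K[x,y]_1` is modeled by the pair
`(p, q) : K × K`; `powVec d (p,q)` is the coefficient vector of `(p*x + q*y)^d`.
-/

/-- Coefficient vector of `(p*x + q*y)^d` in the basis `x^i y^(d-i)`. -/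
noncomputable def powVec {K : Type*} [CommRing K] (d : ℕ) (L : K × K) :
    Fin (d + 1) → K :=
  fun i => (d.choose (i : ℕ) : K) * L.1 ^ (i : ℕ) * L.2 ^ (d - (i : ℕ))

/-- The rank over `K` of a degree-`d` form: the minimal `r` such that
`f = ∑_{i=1}^r c_i L_i^d` with `c_i ∈ K` and linear forms `L_i ∈ K[x,y]_1`. -/
noncomputable def rankK (K : Type*) [CommRing K] (d : ℕ) (f : Fin (d + 1) → K) : ℕ :=
  sInf {r : ℕ | ∃ (c : Fin r → K) (L : Fin r → K × K), f = ∑ i, c i • powVec d (L i)}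

/-- The real rank `Rsr` of a real binary form of degree `d`. -/
noncomputable def Rsr (d : ℕ) (f : Fin (d + 1) → ℝ) : ℕ := rankK ℝ d f

/-- The complex rank `Csr` of a complex binary form of degree `d`. -/
noncomputable def Csr (d : ℕ) (f : Fin (d + 1) → ℂ) : ℕ := rankK ℂ d f

/-- A real form regarded as a complex form (coefficientwise inclusion `ℝ ↪ ℂ`). -/
noncomputable def complexify {d : ℕ} (f : Fin (d + 1) → ℝ) : Fin (d + 1) → ℂ :=
  fun i => (f i : ℂ)

/-- `t` is a typical rank in degree `d`: there is a nonempty euclidean-open set of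
real degree-`d` forms on which the real rank is constantly `t`. -/
def IsTypicalRank (d t : ℕ) : Prop :=
  ∃ V : Set (Fin (d + 1) → ℝ), IsOpen V ∧ V.Nonempty ∧ ∀ f ∈ V, Rsr d f = t

/-- Two linear forms (modeled as coefficient pairs) are proportional if one is a
scalar multiple of the other. -/
def AreProportional {K : Type*} [CommRing K] (u v : K × K) : Prop :=
  ∃ t : K, v = t • u ∨ u = t • v

open Polynomial in
/-- A real polynomial of degree less than `2 * n` with `n` distinct double roots is zero. -/
theorem Polynomial.eq_zero_of_double_roots {n : ℕ} (t : Fin n → ℝ) (ht : Function.Injective t)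
    (P : ℝ[X]) (hdeg : P.degree < (2 * n : ℕ)) (h0 : ∀ j, P.eval (t j) = 0)
    (h1 : ∀ j, P.derivative.eval (t j) = 0) : P = 0 := by
  by_contra hP
  have hdvd : ∏ j, (X - C (t j)) ^ 2 ∣ P := by
    refine Finset.prod_dvd_of_coprime ?_ fun j _ => ?_
    · intro i _ j _ hij
      exact (pairwise_coprime_X_sub_C ht hij).pow
    · exact (le_rootMultiplicity_iff hP).1
        ((one_lt_rootMultiplicity_iff_isRoot hP).2 ⟨h0 j, h1 j⟩)
  have hle := degree_le_of_dvd hdvd hP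
  rw [degree_prod] at hle
  simp only [degree_pow, degree_X_sub_C, Finset.sum_const, Finset.card_univ, Fintype.card_fin]
    at hle
  have hcast : (n • (2 • (1 : WithBot ℕ))) = ((2 * n : ℕ) : WithBot ℕ) := by
    push_cast [nsmul_eq_mul]
    ring
  rw [hcast] at hle
  exact absurd hdeg (not_lt.2 hle)

/-- The tangent vector at `s` of the curve `s ↦ powVec d (s, 1)`. -/
def powVecDeriv (d : ℕ) (s : ℝ) : Fin (d + 1) → ℝ :=
  fun i => (d.choose (i : ℕ) : ℝ) * ((i : ℕ) * s ^ ((i : ℕ) - 1))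

theorem hasStrictDerivAt_powVec (d : ℕ) (s : ℝ) :
    HasStrictDerivAt (fun s : ℝ => powVec d (s, 1)) (powVecDeriv d s) s := by
  rw [hasStrictDerivAt_pi]
  intro i
  simpa [powVec, powVecDeriv] using
    (hasStrictDerivAt_pow (i : ℕ) s).const_mul (d.choose (i : ℕ) : ℝ)

open Polynomial in
/-- The points and tangent vectors of the rational normal curve of degree `2 * m + 1` at `m + 1`
distinct parameters span the space of forms. -/
theorem eq_zero_of_apply_powVec_eq_zero {m : ℕ} (t : Fin (m + 1) → ℝ)
    (ht : Function.Injective t) (φ : (Fin (2 * m + 1 + 1) → ℝ) →ₗ[ℝ] ℝ)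
    (h0 : ∀ j, φ (powVec (2 * m + 1) (t j, 1)) = 0)
    (h1 : ∀ j, φ (powVecDeriv (2 * m + 1) (t j)) = 0) : φ = 0 := by
  let a : Fin (2 * m + 1 + 1) → ℝ := fun i => φ fun j => if i = j then 1 else 0
  have hφ (v : Fin (2 * m + 1 + 1) → ℝ) : φ v = ∑ i, v i * a i := by
    simpa using φ.pi_apply_eq_sum_univ v
  let b : Fin (2 * m + 1 + 1) → ℝ := fun i => ((2 * m + 1).choose (i : ℕ) : ℝ) * a i
  let P : ℝ[X] := ∑ i, C (b i) * X ^ (i : ℕ)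
  have hP : P = 0 := by
    refine eq_zero_of_double_roots t ht P ?_ (fun j => ?_) fun j => ?_
    · exact degree_sum_fin_lt b
    · rw [← h0 j, hφ]
      simp only [P, b, powVec, eval_finsetSum, eval_mul, eval_C, eval_pow, eval_X]
      exact Finset.sum_congr rfl fun i _ => by ring
    · rw [← h1 j, hφ]
      simp only [P, b, powVecDeriv, derivative_sum, derivative_C_mul_X_pow, eval_finsetSum,
        eval_mul, eval_C, eval_pow, eval_X]
      exact Finset.sum_congr rfl fun i _ => by ring
  have ha (i : Fin (2 * m + 1 + 1)) : a i = 0 := by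
    have hc : P.coeff (i : ℕ) = b i := by
      simp [P, coeff_C_mul, coeff_X_pow, Fin.val_inj]
    rw [hP, coeff_zero] at hc
    have hch : ((2 * m + 1).choose (i : ℕ) : ℝ) ≠ 0 :=
      Nat.cast_ne_zero.2 (Nat.choose_pos (Nat.lt_succ_iff.1 i.2)).ne'
    exact (mul_eq_zero.1 hc.symm).resolve_left hch
  ext1 i
  ext
  simp [hφ, ha]

/-- The form `∑ j, c j * (t j * x + y) ^ d` attached to coefficients `c` and parameters `t`. -/
noncomputable def powSum (d n : ℕ) (z : (Fin n → ℝ) × (Fin n → ℝ)) : Fin (d + 1) → ℝ :=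
  ∑ j, z.1 j • powVec d (z.2 j, 1)

/-- Near a sum of `m + 1` powers with distinct parameters and nonzero coefficients, every form of
degree `2 * m + 1` is a sum of `m + 1` powers. -/
theorem range_powSum_mem_nhds {m : ℕ} (c t : Fin (m + 1) → ℝ) (hc : ∀ j, c j ≠ 0)
    (ht : Function.Injective t) :
    Set.range (powSum (2 * m + 1) (m + 1)) ∈ nhds (powSum (2 * m + 1) (m + 1) (c, t)) := by
  let p₁ (j : Fin (m + 1)) : (Fin (m + 1) → ℝ) × (Fin (m + 1) → ℝ) →L[ℝ] ℝ :=
    (ContinuousLinearMap.proj j).comp (ContinuousLinearMap.fst ℝ _ _)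
  let p₂ (j : Fin (m + 1)) : (Fin (m + 1) → ℝ) × (Fin (m + 1) → ℝ) →L[ℝ] ℝ :=
    (ContinuousLinearMap.proj j).comp (ContinuousLinearMap.snd ℝ _ _)
  let D : (Fin (m + 1) → ℝ) × (Fin (m + 1) → ℝ) →L[ℝ] (Fin (2 * m + 1 + 1) → ℝ) :=
    ∑ j, (c j • (p₂ j).smulRight (powVecDeriv (2 * m + 1) (t j)) +
      (p₁ j).smulRight (powVec (2 * m + 1) (t j, 1)))
  have hD : HasStrictFDerivAt (powSum (2 * m + 1) (m + 1)) D (c, t) := by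
    unfold powSum
    refine HasStrictFDerivAt.fun_sum fun j _ => ?_
    have h₁ : HasStrictFDerivAt (fun z : (Fin (m + 1) → ℝ) × (Fin (m + 1) → ℝ) => z.1 j)
        (p₁ j) (c, t) := (p₁ j).hasStrictFDerivAt
    have h₂ : HasStrictFDerivAt (fun z : (Fin (m + 1) → ℝ) × (Fin (m + 1) → ℝ) => z.2 j)
        (p₂ j) (c, t) := (p₂ j).hasStrictFDerivAt
    have h₃ : HasStrictFDerivAt
        (fun z : (Fin (m + 1) → ℝ) × (Fin (m + 1) → ℝ) => powVec (2 * m + 1) (z.2 j, 1))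
        ((p₂ j).smulRight (powVecDeriv (2 * m + 1) (t j))) (c, t) :=
      (hasStrictDerivAt_powVec (2 * m + 1) (t j)).hasStrictFDerivAt.comp (c, t) h₂
    exact h₁.smul h₃
  have hDapply (γ τ : Fin (m + 1) → ℝ) : D (γ, τ) =
      ∑ j, (c j • τ j • powVecDeriv (2 * m + 1) (t j) +
        γ j • powVec (2 * m + 1) (t j, 1)) := by
    simp [D, p₁, p₂]
  have hsurj : D.range = ⊤ := by
    by_contra hne
    obtain ⟨φ, hφ, hle⟩ := Submodule.exists_le_ker_of_lt_top _ (lt_top_iff_ne_top.2 hne)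
    have hker (z) : φ (D z) = 0 := hle (LinearMap.mem_range_self _ z)
    refine hφ (eq_zero_of_apply_powVec_eq_zero t ht φ (fun j => ?_) fun j => ?_)
    · have h := hker (Pi.single j 1, 0)
      rw [hDapply] at h
      simpa [Pi.single_apply] using h
    · have h := hker (0, Pi.single j 1)
      rw [hDapply] at h
      simpa [Pi.single_apply, hc j] using h
  rw [← hD.map_nhds_eq_of_surj hsurj]
  exact Filter.range_mem_map

/-- The middle catalecticant matrix of a form of degree `2 * m + 1`. -/
noncomputable def catalecticant (m : ℕ) (f : Fin (2 * m + 1 + 1) → ℝ) :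
    Matrix (Fin (m + 1)) (Fin (m + 1)) ℝ :=
  Matrix.of fun k l => f ⟨k + l, by omega⟩ / ((2 * m + 1).choose (k + l) : ℝ)

theorem catalecticant_sum {m r : ℕ} (c : Fin r → ℝ) (L : Fin r → ℝ × ℝ) :
    catalecticant m (∑ i, c i • powVec (2 * m + 1) (L i)) =
      (Matrix.of fun (k : Fin (m + 1)) (i : Fin r) =>
        c i * (L i).2 * ((L i).1 ^ (k : ℕ) * (L i).2 ^ (m - (k : ℕ)))) *
      (Matrix.of fun (i : Fin r) (l : Fin (m + 1)) =>
        (L i).1 ^ (l : ℕ) * (L i).2 ^ (m - (l : ℕ))) := by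
  ext k l
  have hch : ((2 * m + 1).choose (k + l) : ℝ) ≠ 0 :=
    Nat.cast_ne_zero.2 (Nat.choose_pos (by omega)).ne'
  simp only [catalecticant, Matrix.of_apply, Matrix.mul_apply, Finset.sum_apply, Pi.smul_apply,
    powVec, smul_eq_mul, Finset.sum_div]
  refine Finset.sum_congr rfl fun i _ => ?_
  have he : 2 * m + 1 - ((k : ℕ) + l) = 1 + (m - k) + (m - l) := by omega
  rw [he]
  field_simp
  ring

theorem det_catalecticant_sum_eq_zero {m r : ℕ} (hr : r ≤ m) (c : Fin r → ℝ)
    (L : Fin r → ℝ × ℝ) :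
    (catalecticant m (∑ i, c i • powVec (2 * m + 1) (L i))).det = 0 := by
  rw [catalecticant_sum]
  by_contra h
  have hrank := Matrix.rank_of_isUnit _ ((Matrix.isUnit_iff_isUnit_det _).2 (IsUnit.mk0 _ h))
  have hle := hrank.ge.trans ((Matrix.rank_mul_le_left _ _).trans (Matrix.rank_le_card_width _))
  rw [Fintype.card_fin, Fintype.card_fin] at hle
  omega

theorem det_catalecticant_powSum_ne_zero {m : ℕ} (t : Fin (m + 1) → ℝ)
    (ht : Function.Injective t) :
    (catalecticant m (powSum (2 * m + 1) (m + 1) (1, t))).det ≠ 0 := by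
  rw [powSum, catalecticant_sum _ fun j => (t j, 1), Matrix.det_mul]
  have hV : (Matrix.vandermonde t).det ≠ 0 := Matrix.det_vandermonde_ne_zero_iff.2 ht
  refine mul_ne_zero ?_ ?_
  · rw [← Matrix.det_transpose]
    convert hV using 2
    ext i j
    simp [Matrix.vandermonde_apply]
  · convert hV using 2
    ext i j
    simp [Matrix.vandermonde_apply]

/-- For odd `d = 2m+1 ≥ 5`, the integer `m + 1` is a typical rank for real
bivariate degree-`d` forms. -/
theorem typical_rank_m_add_one (m : ℕ) (hm : 5 ≤ 2 * m + 1) :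
    IsTypicalRank (2 * m + 1) (m + 1) := by
  let t : Fin (m + 1) → ℝ := fun j => (j : ℕ)
  have ht : Function.Injective t := fun i j h => Fin.ext (Nat.cast_injective h)
  have hcont : Continuous fun f : Fin (2 * m + 1 + 1) → ℝ => (catalecticant m f).det := by
    refine Continuous.matrix_det (continuous_matrix fun k l => ?_)
    exact (continuous_apply _).div_const _
  refine ⟨interior (Set.range (powSum (2 * m + 1) (m + 1))) ∩ {f | (catalecticant m f).det ≠ 0},
    isOpen_interior.inter (isOpen_ne_fun hcont continuous_const),
    ⟨powSum (2 * m + 1) (m + 1) (1, t), ?_, det_catalecticant_powSum_ne_zero t ht⟩, ?_⟩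
  · exact mem_interior_iff_mem_nhds.2 (range_powSum_mem_nhds 1 t (fun _ => one_ne_zero) ht)
  · rintro f ⟨hf, hdet⟩
    obtain ⟨z, rfl⟩ := interior_subset hf
    have hmem : m + 1 ∈ {r : ℕ | ∃ (c : Fin r → ℝ) (L : Fin r → ℝ × ℝ),
        powSum (2 * m + 1) (m + 1) z = ∑ i, c i • powVec (2 * m + 1) (L i)} :=
      ⟨z.1, fun j => (z.2 j, 1), rfl⟩
    refine le_antisymm (Nat.sInf_le hmem) (le_csInf ⟨_, hmem⟩ ?_)
    rintro r ⟨c, L, h⟩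
    by_contra! hr
    refine hdet ?_
    rw [h]
    exact det_catalecticant_sum_eq_zero (Nat.le_of_lt_succ hr) c L
end

section
/- Let d = 2m + 1 ≥ 5 be odd. Let M_1, …, M_{m+1} ∈ ℂ[x,y]_1 be pairwise non-proportional complex linear forms whose set of associated points in ℙ^1(ℂ) is stable under complex conjugation and contains at least one non-real point, and let N_1, …, N_{m+2} ∈ ℝ[x,y]_1 be pairwise non-proportional real linear forms, with no N_j proportional to any M_i. Then the intersection of the complex linear spans span_ℂ{M_1^d, …, M_{m+1}^d} and span_ℂ{N_1^d, …, N_{m+2}^d} inside ℂ[x,y]_d is a one-dimensional subspace, spanned by a nonzero form g with real coefficients, and this g satisfies Csr(g) = m + 1 and Rsr(g) = m + 2. -/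
/-- A complex linear form (as a coefficient pair) is real, i.e. proportional to
a linear form with real coefficients. -/
def IsRealForm (v : ℂ × ℂ) : Prop :=
  ∃ (N : ℝ × ℝ) (t : ℂ), N ≠ 0 ∧ v = t • ((N.1 : ℂ), (N.2 : ℂ))

/-- Coefficientwise complex conjugation of a linear form. -/
noncomputable def conj2 (v : ℂ × ℂ) : ℂ × ℂ :=
  ((starRingEnd ℂ) v.1, (starRingEnd ℂ) v.2)

/-- The determinant of two linear forms, given by their coefficient pairs. -/
def formDet {K : Type*} [CommRing K] (u v : K × K) : K := u.1 * v.2 - u.2 * v.1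

lemma formDet_self {K : Type*} [CommRing K] (u : K × K) : formDet u u = 0 := by
  simp [formDet, mul_comm]

lemma formDet_eq_zero_comm {K : Type*} [CommRing K] {u v : K × K} :
    formDet u v = 0 ↔ formDet v u = 0 := by
  have h : formDet u v = -formDet v u := by simp only [formDet]; ring
  rw [h, neg_eq_zero]

lemma exists_smul_of_formDet_eq_zero {K : Type*} [Field K] {u v : K × K} (hu : u ≠ 0)
    (h : formDet u v = 0) : ∃ t : K, v = t • u := by
  obtain ⟨p, q⟩ := u
  obtain ⟨r, s⟩ := v
  simp only [formDet] at h
  by_cases hp : p = 0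
  · have hq : q ≠ 0 := by rintro rfl; exact hu (by simp [hp])
    have hr : r = 0 := by simpa [hp, hq] using h
    exact ⟨s / q, by simp [hp, hr, hq]⟩
  · refine ⟨r / p, ?_⟩
    ext
    · simp [hp]
    · simp only [Prod.smul_mk, smul_eq_mul]
      field_simp
      linear_combination h

lemma areProportional_iff_formDet_eq_zero {K : Type*} [Field K] {u v : K × K} :
    AreProportional u v ↔ formDet u v = 0 := by
  constructor
  · rintro ⟨t, rfl | rfl⟩ <;> simp only [formDet, Prod.smul_fst, Prod.smul_snd, smul_eq_mul] <;>
      ring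
  · intro h
    by_cases hu : u = 0
    · exact ⟨0, Or.inr (by simp [hu])⟩
    · obtain ⟨t, ht⟩ := exists_smul_of_formDet_eq_zero hu h
      exact ⟨t, Or.inl ht⟩

lemma exists_formDet_ne_zero {K : Type*} [Field K] {u : K × K} (hu : u ≠ 0) :
    ∃ w : K × K, formDet u w ≠ 0 := by
  by_cases h : u.1 = 0
  · refine ⟨(1, 0), fun h' => hu (Prod.ext h ?_)⟩
    simpa [formDet] using h'
  · exact ⟨(0, 1), by simpa [formDet] using h⟩

/-- A product of `d` linear forms is homogeneous of degree `d`. -/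
lemma exists_coeff_prod_formDet {K : Type*} [CommRing K] (d : ℕ) (A : Fin d → K × K) :
    ∃ c : ℕ → K, ∀ v : K × K,
      ∏ j, formDet v (A j) = ∑ i ∈ Finset.range (d + 1), c i * v.1 ^ i * v.2 ^ (d - i) := by
  induction d with
  | zero => exact ⟨fun _ => 1, by simp⟩
  | succ d ih =>
    obtain ⟨c, hc⟩ := ih fun j => A j.succ
    refine ⟨fun i => (if i = 0 then 0 else c (i - 1) * (A 0).2) -
      (if i = d + 1 then 0 else c i * (A 0).1), fun v => ?_⟩
    rw [Fin.prod_univ_succ, hc]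
    have h1 : ∑ i ∈ Finset.range (d + 1 + 1),
        (if i = 0 then 0 else c (i - 1) * (A 0).2) * v.1 ^ i * v.2 ^ (d + 1 - i) =
        v.1 * (A 0).2 * ∑ i ∈ Finset.range (d + 1), c i * v.1 ^ i * v.2 ^ (d - i) := by
      rw [Finset.sum_range_succ', Finset.mul_sum]
      simp only [if_true, zero_mul, add_zero]
      refine Finset.sum_congr rfl fun i _ => ?_
      rw [if_neg (Nat.succ_ne_zero i), Nat.add_sub_cancel, Nat.add_sub_add_right]
      ring
    have h2 : ∑ i ∈ Finset.range (d + 1 + 1),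
        (if i = d + 1 then 0 else c i * (A 0).1) * v.1 ^ i * v.2 ^ (d + 1 - i) =
        v.2 * (A 0).1 * ∑ i ∈ Finset.range (d + 1), c i * v.1 ^ i * v.2 ^ (d - i) := by
      rw [Finset.sum_range_succ, Finset.mul_sum]
      simp only [if_true, zero_mul, add_zero]
      refine Finset.sum_congr rfl fun i hi => ?_
      have hi' := Finset.mem_range.1 hi
      rw [if_neg hi'.ne, Nat.succ_sub (Nat.lt_succ_iff.1 hi'), pow_succ]
      ring
    simp only [sub_mul, Finset.sum_sub_distrib, h1, h2, formDet]

lemma exists_dual_powVec_eq_prod_formDet {K : Type*} [Field K] [CharZero K] (d : ℕ)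
    (A : Fin d → K × K) :
    ∃ φ : (Fin (d + 1) → K) →ₗ[K] K, ∀ v, φ (powVec d v) = ∏ j, formDet v (A j) := by
  obtain ⟨c, hc⟩ := exists_coeff_prod_formDet d A
  refine ⟨∑ i : Fin (d + 1), (c i / (d.choose i : K)) • LinearMap.proj i, fun v => ?_⟩
  rw [hc, Finset.sum_range]
  simp only [LinearMap.sum_apply, LinearMap.smul_apply, LinearMap.proj_apply, smul_eq_mul]
  refine Finset.sum_congr rfl fun i _ => ?_
  have : (d.choose i : K) ≠ 0 := by
    exact_mod_cast (Nat.choose_pos (Nat.lt_succ_iff.1 i.2)).ne'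
  simp only [powVec]
  field_simp

lemma powVec_zero {K : Type*} [CommRing K] {d : ℕ} (hd : d ≠ 0) : powVec d (0 : K × K) = 0 := by
  funext i
  by_cases hi : (i : ℕ) = 0
  · simp [powVec, hi, hd]
  · simp [powVec, hi]

/-- Powers of at most `d` linear forms that are not proportional to `u` are separated from
`u ^ d` by a linear functional. -/
lemma exists_dual_separating_powVec {K : Type*} [Field K] [CharZero K] {d : ℕ} (hd : d ≠ 0)
    {ι : Type*} [Fintype ι] (hι : Fintype.card ι ≤ d) (A : ι → K × K) {u : K × K} (hu : u ≠ 0) :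
    ∃ φ : (Fin (d + 1) → K) →ₗ[K] K, φ (powVec d u) ≠ 0 ∧
      ∀ k, (A k ≠ 0 → formDet u (A k) ≠ 0) → φ (powVec d (A k)) = 0 := by
  classical
  obtain ⟨w, hw⟩ := exists_formDet_ne_zero hu
  obtain ⟨e⟩ : Nonempty (ι ↪ Fin d) :=
    Function.Embedding.nonempty_of_card_le (by simpa using hι)
  let B : ι → K × K := fun k => if formDet u (A k) = 0 then w else A k
  obtain ⟨φ, hφ⟩ := exists_dual_powVec_eq_prod_formDet d (Function.extend e B fun _ => w)
  refine ⟨φ, ?_, fun k hk => ?_⟩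
  · rw [hφ, Finset.prod_ne_zero_iff]
    intro j _
    by_cases hj : ∃ k, e k = j
    · obtain ⟨k, rfl⟩ := hj
      rw [e.injective.extend_apply]
      by_cases h : formDet u (A k) = 0
      · simp [B, h, hw]
      · simp [B, h]
    · rwa [Function.extend_apply' _ _ _ hj]
  · by_cases h0 : A k = 0
    · rw [h0, powVec_zero hd, map_zero]
    · rw [hφ]
      refine Finset.prod_eq_zero (Finset.mem_univ (e k)) ?_
      rw [e.injective.extend_apply]
      simp only [B, if_neg (hk h0), formDet_self]

/-- A relation among the `d`-th powers of `d + 2` pairwise non-proportional linear forms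
has either all or none of its coefficients equal to zero. -/
lemma eq_zero_of_sum_smul_powVec_eq_zero {K : Type*} [Field K] [CharZero K] {d : ℕ} (hd : d ≠ 0)
    {ι : Type*} [Fintype ι] (hι : Fintype.card ι = d + 2) {F : ι → K × K} (hF0 : ∀ i, F i ≠ 0)
    (hF : ∀ i j, i ≠ j → formDet (F i) (F j) ≠ 0) {c : ι → K}
    (hc : ∑ i, c i • powVec d (F i) = 0) {k : ι} (hk : c k = 0) : c = 0 := by
  classical
  by_contra hne
  obtain ⟨l, hl⟩ := Function.ne_iff.1 hne
  have hlk : l ≠ k := by rintro rfl; exact hl hk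
  have hcard : Fintype.card {i // i ∉ ({k, l} : Finset ι)} ≤ d := by
    rw [Fintype.card_subtype_compl, hι, Fintype.card_coe, Finset.card_pair hlk.symm,
      Nat.add_sub_cancel]
  obtain ⟨φ, h1, h2⟩ := exists_dual_separating_powVec hd hcard (fun i => F i.1) (hF0 l)
  have h := congrArg φ hc
  rw [map_sum, map_zero, Finset.sum_eq_single l] at h
  · rw [map_smul, smul_eq_mul] at h
    exact (mul_ne_zero hl h1) h
  · intro i _ hil
    rw [map_smul]
    by_cases hik : i = k
    · rw [hik, hk, zero_smul]
    · rw [h2 ⟨i, by simp [hik, hil]⟩ fun _ => hF l i hil.symm, smul_zero]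
  · simp

/-- Two decompositions of a form with few summands in total share their linear forms. -/
lemma exists_formDet_eq_zero_of_sum_eq {K : Type*} [Field K] [CharZero K] {d m r : ℕ} (hd : d ≠ 0)
    (hr : r + m ≤ d) {M : Fin (m + 1) → K × K} (hM0 : ∀ i, M i ≠ 0)
    (hM : ∀ i j, i ≠ j → formDet (M i) (M j) ≠ 0) {a : Fin (m + 1) → K} {c : Fin r → K}
    {L : Fin r → K × K} (h : ∑ i, a i • powVec d (M i) = ∑ k, c k • powVec d (L k))
    {i : Fin (m + 1)} (hi : a i ≠ 0) : ∃ k, L k ≠ 0 ∧ formDet (M i) (L k) = 0 := by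
  classical
  by_contra! hcon
  have hcard : Fintype.card (Fin r ⊕ {j // j ≠ i}) ≤ d := by
    simpa [Fintype.card_subtype_compl] using hr
  obtain ⟨φ, h1, h2⟩ := exists_dual_separating_powVec hd hcard
    (Sum.elim L fun j => M j.1) (hM0 i)
  have h := congrArg φ h
  rw [map_sum, map_sum, Finset.sum_eq_single i, Finset.sum_eq_zero] at h
  · rw [map_smul, smul_eq_mul] at h
    exact (mul_ne_zero hi h1) h
  · intro k _
    rw [map_smul]
    have := h2 (Sum.inl k) (hcon k)
    rw [Sum.elim_inl] at this
    rw [this, smul_zero]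
  · intro j _ hj
    rw [map_smul]
    have := h2 (Sum.inr ⟨j, hj⟩) fun _ => hM i j hj.symm
    rw [Sum.elim_inr] at this
    rw [this, smul_zero]
  · simp

lemma rankK_eq_of_forall_le {K : Type*} [CommRing K] {d r : ℕ} {f : Fin (d + 1) → K}
    {c : Fin r → K} {L : Fin r → K × K} (hf : f = ∑ i, c i • powVec d (L i))
    (hmin : ∀ (s : ℕ) (c : Fin s → K) (L : Fin s → K × K),
      f = ∑ i, c i • powVec d (L i) → r ≤ s) : rankK K d f = r := by
  refine le_antisymm (Nat.sInf_le ⟨c, L, hf⟩) (le_csInf ⟨r, c, L, hf⟩ ?_)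
  rintro s ⟨c', L', h⟩
  exact hmin s c' L' h

lemma rankK_eq_of_sum_smul_powVec {K : Type*} [Field K] [CharZero K] {d m : ℕ} (hd : d ≠ 0)
    (hmd : m + m ≤ d) {M : Fin (m + 1) → K × K} (hM0 : ∀ i, M i ≠ 0)
    (hM : ∀ i j, i ≠ j → formDet (M i) (M j) ≠ 0) {a : Fin (m + 1) → K} (ha : ∀ i, a i ≠ 0) :
    rankK K d (∑ i, a i • powVec d (M i)) = m + 1 := by
  refine rankK_eq_of_forall_le rfl fun r c L h => ?_
  by_contra! hr
  choose k hk0 hk using fun i =>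
    exists_formDet_eq_zero_of_sum_eq hd (by lia : r + m ≤ d) hM0 hM h (ha i)
  have hinj : Function.Injective k := by
    intro i j hij
    by_contra hne
    obtain ⟨s, hs⟩ := exists_smul_of_formDet_eq_zero (hk0 i) (formDet_eq_zero_comm.1 (hk i))
    obtain ⟨t, ht⟩ := exists_smul_of_formDet_eq_zero (hk0 j) (formDet_eq_zero_comm.1 (hk j))
    refine hM i j hne ?_
    rw [hs, ht, hij]
    simp only [formDet, Prod.smul_fst, Prod.smul_snd, smul_eq_mul]
    ring
  have := Fintype.card_le_of_injective k hinj
  simp only [Fintype.card_fin] at this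
  lia

lemma powVec_smul {K : Type*} [CommRing K] (d : ℕ) (t : K) (v : K × K) :
    powVec d (t • v) = t ^ d • powVec d v := by
  funext i
  have : t ^ d = t ^ (i : ℕ) * t ^ (d - (i : ℕ)) := by
    rw [← pow_add, Nat.add_sub_cancel' (Nat.lt_succ_iff.1 i.2)]
  simp only [powVec, Prod.smul_fst, Prod.smul_snd, Pi.smul_apply, smul_eq_mul, mul_pow, this]
  ring

lemma complexify_sum_smul_powVec {d : ℕ} {ι : Type*} [Fintype ι] (c : ι → ℝ) (L : ι → ℝ × ℝ) :
    complexify (∑ k, c k • powVec d (L k)) =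
      ∑ k, (c k : ℂ) • powVec d (((L k).1 : ℂ), ((L k).2 : ℂ)) := by
  funext i
  simp [complexify, powVec, Finset.sum_apply]

lemma star_sum_smul_powVec {d : ℕ} {ι : Type*} [Fintype ι] (c : ι → ℂ) (L : ι → ℂ × ℂ) :
    star (∑ k, c k • powVec d (L k)) = ∑ k, star (c k) • powVec d (conj2 (L k)) := by
  funext i
  simp [powVec, conj2, Finset.sum_apply]

lemma star_sum_smul_powVec_mem_span {d : ℕ} {ι : Type*} [Fintype ι] {M : ι → ℂ × ℂ}
    (hM0 : ∀ i, M i ≠ 0) (hconj : ∀ i, ∃ j, AreProportional (conj2 (M i)) (M j)) (a : ι → ℂ) :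
    star (∑ i, a i • powVec d (M i)) ∈
      Submodule.span ℂ (Set.range fun i => powVec d (M i)) := by
  rw [star_sum_smul_powVec]
  refine Submodule.sum_mem _ fun i _ => Submodule.smul_mem _ _ ?_
  obtain ⟨j, hj⟩ := hconj i
  obtain ⟨t, ht⟩ := exists_smul_of_formDet_eq_zero (hM0 j)
    (formDet_eq_zero_comm.1 (areProportional_iff_formDet_eq_zero.1 hj))
  rw [ht, powVec_smul]
  exact Submodule.smul_mem _ _ (Submodule.subset_span ⟨j, rfl⟩)

lemma isRealForm_of_formDet_eq_zero {v : ℂ × ℂ} {L : ℝ × ℝ} (hL : L ≠ 0)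
    (h : formDet v ((L.1 : ℂ), (L.2 : ℂ)) = 0) : IsRealForm v := by
  have hL' : ((L.1 : ℂ), (L.2 : ℂ)) ≠ 0 := by
    contrapose! hL
    simpa [Prod.ext_iff] using hL
  obtain ⟨t, ht⟩ := exists_smul_of_formDet_eq_zero hL' (formDet_eq_zero_comm.1 h)
  exact ⟨L, t, hL, ht⟩

/-- The unique relation among `2m + 3` pairwise non-proportional forms, split in two groups. -/
lemma exists_common_sum_smul_powVec {K : Type*} [Field K] [CharZero K] {m : ℕ}
    {M : Fin (m + 1) → K × K} {W : Fin (m + 2) → K × K}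
    (huniq : ∀ (a : Fin (m + 1) → K) (b : Fin (m + 2) → K),
      ∑ i, a i • powVec (2 * m + 1) (M i) = ∑ j, b j • powVec (2 * m + 1) (W j) →
      ((∃ i, a i = 0) ∨ ∃ j, b j = 0) → a = 0 ∧ b = 0) :
    ∃ (a : Fin (m + 1) → K) (b : Fin (m + 2) → K),
      ∑ i, a i • powVec (2 * m + 1) (M i) = ∑ j, b j • powVec (2 * m + 1) (W j) ∧
      (∀ i, a i ≠ 0) ∧ (∀ j, b j ≠ 0) ∧ b 0 = 1 := by
  have hdep : ¬ LinearIndependent K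
      fun k : Fin (m + 1) ⊕ Fin (m + 2) => powVec (2 * m + 1) (Sum.elim M W k) := by
    intro h
    have := h.fintype_card_le_finrank
    simp only [Fintype.card_sum, Fintype.card_fin, Module.finrank_fin_fun] at this
    lia
  obtain ⟨c, hc, k, hk⟩ := Fintype.not_linearIndependent_iff.1 hdep
  let a : Fin (m + 1) → K := fun i => c (Sum.inl i)
  let b : Fin (m + 2) → K := fun j => -c (Sum.inr j)
  have hab : ∑ i, a i • powVec (2 * m + 1) (M i) = ∑ j, b j • powVec (2 * m + 1) (W j) := by
    rw [Fintype.sum_sum_type] at hc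
    simpa [a, b] using eq_neg_of_add_eq_zero_left hc
  have hne : ¬ ((∃ i, a i = 0) ∨ ∃ j, b j = 0) := by
    intro h
    obtain ⟨ha, hb⟩ := huniq a b hab h
    rcases k with i | j
    · exact hk (congrFun ha i)
    · exact hk (neg_eq_zero.1 (congrFun hb j))
  push Not at hne
  refine ⟨(b 0)⁻¹ • a, (b 0)⁻¹ • b, ?_, fun i => ?_, fun j => ?_, ?_⟩
  · simp only [Pi.smul_apply, smul_assoc, ← Finset.smul_sum, hab]
  · exact mul_ne_zero (inv_ne_zero (hne.2 0)) (hne.1 i)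
  · exact mul_ne_zero (inv_ne_zero (hne.2 0)) (hne.2 j)
  · exact inv_mul_cancel₀ (hne.2 0)

/-- Let `d = 2m+1 ≥ 5`.  Take pairwise non-proportional complex linear forms
`M_1, …, M_{m+1}` whose set of points is conjugation-stable and contains a
non-real point, and pairwise non-proportional real linear forms
`N_1, …, N_{m+2}`, no `N_j` proportional to any `M_i`.  Then
`span_ℂ{M_i^d} ∩ span_ℂ{N_j^d}` is one-dimensional, spanned by a nonzero real
form `g` with `Csr g = m + 1` and `Rsr g = m + 2`. -/
theorem span_intersection_real_rank (m : ℕ) (hm : 5 ≤ 2 * m + 1)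
    (M : Fin (m + 1) → ℂ × ℂ) (hM0 : ∀ i, M i ≠ 0)
    (hMp : ∀ i j, i ≠ j → ¬ AreProportional (M i) (M j))
    (hconj : ∀ i, ∃ j, AreProportional (conj2 (M i)) (M j))
    (hnr : ∃ i, ¬ IsRealForm (M i))
    (N : Fin (m + 2) → ℝ × ℝ) (hN0 : ∀ j, N j ≠ 0)
    (hNp : ∀ i j, i ≠ j → ¬ AreProportional (N i) (N j))
    (hNM : ∀ j i, ¬ AreProportional (((N j).1 : ℂ), ((N j).2 : ℂ)) (M i)) :
    ∃ g : Fin (2 * m + 1 + 1) → ℝ, complexify g ≠ 0 ∧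
      (Submodule.span ℂ (Set.range fun i => powVec (2 * m + 1) (M i))) ⊓
          (Submodule.span ℂ (Set.range fun j =>
            powVec (2 * m + 1) ((((N j).1 : ℂ), ((N j).2 : ℂ)) : ℂ × ℂ))) =
        Submodule.span ℂ {complexify g} ∧
      Csr (2 * m + 1) (complexify g) = m + 1 ∧
      Rsr (2 * m + 1) g = m + 2 := by
  have hd : 2 * m + 1 ≠ 0 := by lia
  have hM : ∀ i j, i ≠ j → formDet (M i) (M j) ≠ 0 := fun i j hij h =>
    hMp i j hij (areProportional_iff_formDet_eq_zero.2 h)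
  set W : Fin (m + 2) → ℂ × ℂ := fun j => (((N j).1 : ℂ), ((N j).2 : ℂ)) with hW
  have hW0 : ∀ j, W j ≠ 0 := fun j h => hN0 j (by simpa [hW, Prod.ext_iff] using h)
  have hWM : ∀ j i, formDet (W j) (M i) ≠ 0 := fun j i h =>
    hNM j i (areProportional_iff_formDet_eq_zero.2 h)
  have hWW : ∀ i j, i ≠ j → formDet (W i) (W j) ≠ 0 := fun i j hij h =>
    hNp i j hij (areProportional_iff_formDet_eq_zero.2 (by
      simp only [formDet, hW] at h ⊢
      exact_mod_cast h))
  have huniq : ∀ (a : Fin (m + 1) → ℂ) (b : Fin (m + 2) → ℂ),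
      ∑ i, a i • powVec (2 * m + 1) (M i) = ∑ j, b j • powVec (2 * m + 1) (W j) →
      ((∃ i, a i = 0) ∨ ∃ j, b j = 0) → a = 0 ∧ b = 0 := by
    intro a b hab h
    have hF : ∀ k l : Fin (m + 1) ⊕ Fin (m + 2), k ≠ l →
        formDet (Sum.elim M W k) (Sum.elim M W l) ≠ 0 := by
      rintro (i | i) (j | j) hij
      · exact hM i j (by simpa using hij)
      · exact fun h => hWM j i (formDet_eq_zero_comm.1 h)
      · exact hWM i j
      · exact hWW i j (by simpa using hij)
    have hF0 : ∀ k : Fin (m + 1) ⊕ Fin (m + 2), Sum.elim M W k ≠ 0 := by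
      rintro (i | j)
      · exact hM0 i
      · exact hW0 j
    have hcard : Fintype.card (Fin (m + 1) ⊕ Fin (m + 2)) = 2 * m + 1 + 2 := by
      simp only [Fintype.card_sum, Fintype.card_fin]
      lia
    have hc : ∑ k, (Sum.elim a (-b) k) • powVec (2 * m + 1) (Sum.elim M W k) = 0 := by
      simp [Fintype.sum_sum_type, hab]
    have hz : Sum.elim a (-b) = 0 := by
      rcases h with ⟨i, hi⟩ | ⟨j, hj⟩
      · exact eq_zero_of_sum_smul_powVec_eq_zero hd hcard hF0 hF hc (k := Sum.inl i) hi
      · exact eq_zero_of_sum_smul_powVec_eq_zero hd hcard hF0 hF hc (k := Sum.inr j)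
          (by simp [hj])
    exact ⟨funext fun i => congrFun hz (Sum.inl i),
      funext fun j => neg_eq_zero.1 (congrFun hz (Sum.inr j))⟩
  obtain ⟨a, b, hab, ha, hb, hb0⟩ := exists_common_sum_smul_powVec huniq
  have hspan : ∀ (a' : Fin (m + 1) → ℂ) (b' : Fin (m + 2) → ℂ),
      ∑ i, a' i • powVec (2 * m + 1) (M i) = ∑ j, b' j • powVec (2 * m + 1) (W j) →
      b' = b' 0 • b := by
    intro a' b' h
    refine sub_eq_zero.1 (huniq (a' - b' 0 • a) (b' - b' 0 • b) ?_ (Or.inr ⟨0, ?_⟩)).2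
    · simp only [Pi.sub_apply, Pi.smul_apply, sub_smul, Finset.sum_sub_distrib, smul_assoc,
        ← Finset.smul_sum, h, hab]
    · simp [hb0]
  have hconjW : ∀ j, conj2 (W j) = W j := fun j => by simp [conj2, hW]
  have hbreal : ∀ j, ((b j).re : ℂ) = b j := by
    obtain ⟨a', ha'⟩ := (Submodule.mem_span_range_iff_exists_fun ℂ).1
      (star_sum_smul_powVec_mem_span (d := 2 * m + 1) hM0 hconj a)
    rw [hab, star_sum_smul_powVec] at ha'
    simp only [hconjW] at ha'
    intro j
    have := congrFun (hspan a' (fun j => star (b j)) ha') j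
    simp only [hb0, star_one, one_smul] at this
    exact Complex.conj_eq_iff_re.1 this
  have hg : complexify (∑ j, (b j).re • powVec (2 * m + 1) (N j)) =
      ∑ i, a i • powVec (2 * m + 1) (M i) := by
    rw [complexify_sum_smul_powVec, hab]
    simp only [hbreal, hW]
  refine ⟨∑ j, (b j).re • powVec (2 * m + 1) (N j), ?_, ?_, ?_, ?_⟩
  · intro h0
    rw [hg, hab] at h0
    exact hb 0 (congrFun (huniq 0 b (by simp [h0]) (Or.inl ⟨0, rfl⟩)).2 0)
  · rw [hg]
    refine le_antisymm ?_ ?_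
    · rintro f ⟨hfM, hfN⟩
      obtain ⟨a', ha'⟩ := (Submodule.mem_span_range_iff_exists_fun ℂ).1 hfM
      obtain ⟨b', hb'⟩ := (Submodule.mem_span_range_iff_exists_fun ℂ).1 hfN
      rw [Submodule.mem_span_singleton]
      refine ⟨b' 0, ?_⟩
      rw [hab, ← hb', hspan a' b' (ha'.trans hb'.symm)]
      simp only [Pi.smul_apply, Finset.smul_sum, hb0, smul_eq_mul, mul_one, mul_smul, hW]
    · rw [Submodule.span_singleton_le_iff_mem]
      refine ⟨(Submodule.mem_span_range_iff_exists_fun ℂ).2 ⟨a, rfl⟩,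
        (Submodule.mem_span_range_iff_exists_fun ℂ).2 ⟨b, hab.symm⟩⟩
  · rw [hg]
    exact rankK_eq_of_sum_smul_powVec hd (by lia) hM0 hM ha
  · refine rankK_eq_of_forall_le rfl fun r c L h => ?_
    by_contra! hr
    obtain ⟨i, hi⟩ := hnr
    rw [h, complexify_sum_smul_powVec] at hg
    obtain ⟨k, hk0, hk⟩ := exists_formDet_eq_zero_of_sum_eq hd (by lia) hM0 hM hg.symm (ha i)
    exact hi (isRealForm_of_formDet_eq_zero
      (fun h0 => hk0 (by simp [h0])) hk)
end

section
/- Let d ≥ 1 and let a, b ≥ 1 be integers with a + b = d + 2, a ≤ d + 1, b ≤ d + 1. Let L_1, …, L_a, M_1, …, M_b ∈ ℂ[x,y]_1 be d + 2 pairwise non-proportional nonzero linear forms. Then the intersection span_ℂ{L_1^d, …, L_a^d} ∩ span_ℂ{M_1^d, …, M_b^d} inside ℂ[x,y]_d is a one-dimensional subspace. -/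
/-- Linear forms with vanishing determinant are proportional, provided the first is nonzero. -/
theorem areProportional_of_mul_eq {K : Type*} [Field K] {u v : K × K} (hu : u ≠ 0)
    (h : v.1 * u.2 = u.1 * v.2) : AreProportional u v := by
  obtain ⟨p, q⟩ := u
  obtain ⟨r, s⟩ := v
  simp only at h
  by_cases hp : p = 0
  · have hq : q ≠ 0 := fun hq => hu (by simp [hp, hq])
    refine ⟨s / q, Or.inl ?_⟩
    have hr : r = 0 := by simpa [hp, hq] using h
    simp [hp, hr, hq]
  · refine ⟨r / p, Or.inl ?_⟩
    have hs : s = r / p * q := by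
      field_simp
      linear_combination -h
    simp [hp, ← hs]

theorem areProportional_comm {K : Type*} [CommRing K] {u v : K × K} :
    AreProportional u v ↔ AreProportional v u :=
  exists_congr fun _ => or_comm

/-- The `d`-th powers of `d + 1` pairwise non-proportional linear forms are independent. -/
theorem linearIndependent_powVec {K : Type*} [Field K] [CharZero K] {d : ℕ}
    (P : Fin (d + 1) → K × K) (h0 : ∀ i, P i ≠ 0)
    (hP : ∀ i j, i ≠ j → ¬ AreProportional (P i) (P j)) :
    LinearIndependent K fun i => powVec d (P i) := by
  let A : Matrix (Fin (d + 1)) (Fin (d + 1)) K :=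
    Matrix.projVandermonde (fun i => (P i).1) (fun i => (P i).2) *
      Matrix.diagonal fun j : Fin (d + 1) => (d.choose j : K)
  have hA : A.det ≠ 0 := by
    rw [Matrix.det_mul, Matrix.det_projVandermonde, Matrix.det_diagonal]
    refine mul_ne_zero (Finset.prod_ne_zero_iff.2 fun i _ =>
      Finset.prod_ne_zero_iff.2 fun j hj h => ?_) (Finset.prod_ne_zero_iff.2 fun j _ => ?_)
    · exact hP i j (Finset.mem_Ioi.1 hj).ne (areProportional_of_mul_eq (h0 i) (sub_eq_zero.1 h))
    · exact Nat.cast_ne_zero.2 (Nat.choose_pos (Nat.lt_succ_iff.1 j.2)).ne'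
  have hrow := Matrix.linearIndependent_rows_of_det_ne_zero hA
  suffices h : (fun i => powVec d (P i)) = A.row by rwa [h]
  ext i j
  have hj : (j.rev : ℕ) = d - j := by
    rw [Fin.val_rev]
    omega
  simp only [powVec, A, Matrix.row, Matrix.mul_diagonal, Matrix.projVandermonde_apply, hj]
  ring

/-- The `d`-th powers of any `d + 1` members of a pairwise non-proportional family of linear
forms are independent. -/
theorem linearIndepOn_powVec {K ι : Type*} [Field K] [CharZero K] {d : ℕ} (P : ι → K × K)
    (h0 : ∀ i, P i ≠ 0) (hP : ∀ i j, i ≠ j → ¬ AreProportional (P i) (P j))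
    (t : Finset ι) (ht : t.card = d + 1) :
    LinearIndepOn K (fun i => powVec d (P i)) (t : Set ι) := by
  let e : Fin (d + 1) ≃ t := (t.equivFinOfCardEq ht).symm
  have h := linearIndependent_powVec (fun i => P (e i)) (fun i => h0 _)
    fun i j hij => hP _ _ fun h => hij (e.injective (Subtype.ext h))
  exact (linearIndependent_equiv e).1 h

/-- If `a + b = d + 2` with `a, b ≤ d + 1`, and `L_1, …, L_a, M_1, …, M_b` are
`d + 2` pairwise non-proportional nonzero complex linear forms, then
`span_ℂ{L_i^d} ∩ span_ℂ{M_j^d}` is a one-dimensional subspace of `ℂ[x,y]_d`. -/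
theorem span_intersection_one_dimensional (d a b : ℕ) (hd : 1 ≤ d)
    (hab : a + b = d + 2) (ha : a ≤ d + 1) (hb : b ≤ d + 1)
    (L : Fin a → ℂ × ℂ) (M : Fin b → ℂ × ℂ)
    (hL0 : ∀ i, L i ≠ 0) (hM0 : ∀ j, M j ≠ 0)
    (hLL : ∀ i j, i ≠ j → ¬ AreProportional (L i) (L j))
    (hMM : ∀ i j, i ≠ j → ¬ AreProportional (M i) (M j))
    (hLM : ∀ i j, ¬ AreProportional (L i) (M j)) :
    Module.finrank ℂ
      ↥((Submodule.span ℂ (Set.range fun i => powVec d (L i))) ⊓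
        (Submodule.span ℂ (Set.range fun j => powVec d (M j)))) = 1 := by
  let P : Fin a ⊕ Fin b → ℂ × ℂ := Sum.elim L M
  have h0 : ∀ i, P i ≠ 0 := Sum.rec hL0 hM0
  have hP : ∀ i j, i ≠ j → ¬ AreProportional (P i) (P j) := by
    rintro (i | i) (j | j) hij
    · exact hLL i j fun h => hij (congrArg _ h)
    · exact hLM i j
    · exact fun h => hLM j i (areProportional_comm.1 h)
    · exact hMM i j fun h => hij (congrArg _ h)
  have hcard : Fintype.card (Fin a ⊕ Fin b) = d + 2 := by simp [hab]
  have hind : ∀ s : Finset (Fin a ⊕ Fin b), s.card ≤ d + 1 →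
      LinearIndepOn ℂ (fun i => powVec d (P i)) (s : Set (Fin a ⊕ Fin b)) := by
    intro s hs
    obtain ⟨t, hst, ht⟩ := Finset.exists_superset_card_eq hs (by omega)
    exact (linearIndepOn_powVec P h0 hP t ht).mono (Finset.coe_subset.2 hst)
  have hL : LinearIndependent ℂ fun i => powVec d (L i) :=
    (hind (Finset.univ.map .inl) (by simpa using ha)).comp
      (fun i : Fin a => ⟨Sum.inl i, by simp⟩)
      fun i j h => Sum.inl_injective (congrArg Subtype.val h)
  have hM : LinearIndependent ℂ fun i => powVec d (M i) :=
    (hind (Finset.univ.map .inr) (by simpa using hb)).comp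
      (fun i : Fin b => ⟨Sum.inr i, by simp⟩)
      fun i j h => Sum.inr_injective (congrArg Subtype.val h)
  have hsup : Submodule.span ℂ (Set.range fun i => powVec d (L i)) ⊔
      Submodule.span ℂ (Set.range fun j => powVec d (M j)) = ⊤ := by
    obtain ⟨t, -, ht⟩ := Finset.exists_superset_card_eq (s := ∅) (n := d + 1)
      (α := Fin a ⊕ Fin b) (by simp) (by omega)
    have hspan := LinearIndependent.span_eq_top_of_card_eq_finrank' (hind t ht.le)
      (by simp [ht])
    rw [← Submodule.span_union, eq_top_iff, ← hspan]
    refine Submodule.span_mono ?_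
    rintro _ ⟨⟨i | i, _⟩, rfl⟩
    · exact Or.inl ⟨i, rfl⟩
    · exact Or.inr ⟨i, rfl⟩
  have hdim := Submodule.finrank_sup_add_finrank_inf_eq
    (Submodule.span ℂ (Set.range fun i => powVec d (L i)))
    (Submodule.span ℂ (Set.range fun j => powVec d (M j)))
  rw [hsup, finrank_top, finrank_span_eq_card hL, finrank_span_eq_card hM] at hdim
  simp only [Module.finrank_fin_fun, Fintype.card_fin] at hdim
  omega
end
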